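/- For a generic arrangement of n ≥ 2 hyperplanes in ℂ³, the first homology of the Milnor fiber boundary computed from its plumbing graph is ℤ^{n(n−1)/2} ⊕ (ℤ/nℤ)^{(n−2)(n−3)/2}; i.e., corank(A_n) + b₁(Γ) = n(n−1)/2 and the torsion of coker(A_n) is (ℤ/nℤ)^{(n−2)(n−3)/2}, where all genera in the graph are zero. -/

import Mathlib

open Matrix

/-- Index type for the rows of `X n`: pairs `(i,j)` with `i < j` in `Fin n`. -/
abbrev PairIdx (n : ℕ) := {p : Fin n × Fin n // p.1 < p.2}

/-- The matrix `X n` whose row indexed by `(i,j)` (with `i < j`) is `e i - e j`. -/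
def Xmat (n : ℕ) : Matrix (PairIdx n) (Fin n) ℤ :=
  Matrix.of fun p k => (if k = p.1.1 then 1 else 0) - (if k = p.1.2 then 1 else 0)

/-- The matrix `X n` over `ℚ`. -/
def XmatQ (n : ℕ) : Matrix (PairIdx n) (Fin n) ℚ :=
  Matrix.of fun p k => (if k = p.1.1 then 1 else 0) - (if k = p.1.2 then 1 else 0)

/-- The weighted incidence matrix `A n = [[−E, −Xᵀ],[−X, −n·E]]` of the plumbing graph. -/
def Amat (n : ℕ) : Matrix (Fin n ⊕ PairIdx n) (Fin n ⊕ PairIdx n) ℤ :=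
  Matrix.fromBlocks (-1) (-(Xmat n)ᵀ) (-(Xmat n)) (-((n : ℤ) • 1))

/-- The matrix `A n` over `ℚ`. -/
def AmatQ (n : ℕ) : Matrix (Fin n ⊕ PairIdx n) (Fin n ⊕ PairIdx n) ℚ :=
  Matrix.fromBlocks (-1) (-(XmatQ n)ᵀ) (-(XmatQ n)) (-((n : ℚ) • 1))

section Incidence

variable {R : Type*} [CommRing R] {n : ℕ}

/-- The matrix with rows `e i - e j`, over an arbitrary commutative ring. -/
def pairIncidence (R : Type*) [CommRing R] (n : ℕ) : Matrix (PairIdx n) (Fin n) R :=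
  Matrix.of fun p k => (if k = p.1.1 then 1 else 0) - (if k = p.1.2 then 1 else 0)

/-- The extension of a function on pairs `i < j` to an antisymmetric function. -/
def antisymmetrize (b : PairIdx n → R) (i j : Fin n) : R :=
  if h : i < j then b ⟨(i, j), h⟩ else if h : j < i then -b ⟨(j, i), h⟩ else 0

lemma antisymmetrize_pair (b : PairIdx n → R) (p : PairIdx n) :
    antisymmetrize b p.1.1 p.1.2 = b p := by
  simp [antisymmetrize, p.2]

lemma antisymmetrize_neg_swap (b : PairIdx n → R) (i j : Fin n) :
    antisymmetrize b i j = -antisymmetrize b j i := by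
  rcases lt_trichotomy i j with h | h | h
  · simp [antisymmetrize, h, h.asymm]
  · simp [antisymmetrize, h]
  · simp [antisymmetrize, h, h.asymm]

lemma antisymmetrize_self (b : PairIdx n → R) (i : Fin n) : antisymmetrize b i i = 0 := by
  simp [antisymmetrize]

lemma antisymmetrize_add (b c : PairIdx n → R) (i j : Fin n) :
    antisymmetrize (b + c) i j = antisymmetrize b i j + antisymmetrize c i j := by
  unfold antisymmetrize
  split_ifs <;> simp [add_comm]

lemma antisymmetrize_of_antisymm {z : Fin n → Fin n → R} (hz : ∀ i j, z i j = -z j i)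
    (hz' : ∀ i, z i i = 0) (i j : Fin n) :
    antisymmetrize (fun p => z p.1.1 p.1.2) i j = z i j := by
  rcases lt_trichotomy i j with h | h | h
  · simp [antisymmetrize, h]
  · simp [antisymmetrize, h, hz']
  · simp [antisymmetrize, h, h.asymm, hz i j]

lemma sum_sum_antisymmetrize (b : PairIdx n → R) :
    ∑ i, ∑ j, antisymmetrize b i j = 0 := by
  have key : ∀ i j : Fin n, antisymmetrize b i j =
      (if h : i < j then b ⟨(i, j), h⟩ else 0) - (if h : j < i then b ⟨(j, i), h⟩ else 0) := by
    intro i j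
    rcases lt_trichotomy i j with h | h | h
    · simp [antisymmetrize, h, h.asymm]
    · simp [antisymmetrize, h]
    · simp [antisymmetrize, h, h.asymm]
  simp only [key, Finset.sum_sub_distrib]
  rw [sub_eq_zero, Finset.sum_comm]

lemma pairIncidence_mulVec (a : Fin n → R) (p : PairIdx n) :
    (pairIncidence R n *ᵥ a) p = a p.1.1 - a p.1.2 := by
  simp [pairIncidence, mulVec, dotProduct, sub_mul, Finset.sum_sub_distrib]

lemma antisymmetrize_pairIncidence_mulVec (a : Fin n → R) (i j : Fin n) :
    antisymmetrize (pairIncidence R n *ᵥ a) i j = a i - a j := by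
  have : pairIncidence R n *ᵥ a = fun p => a p.1.1 - a p.1.2 := by
    ext p
    exact pairIncidence_mulVec a p
  rw [this]
  exact antisymmetrize_of_antisymm (z := fun i j => a i - a j) (by simp) (by simp) i j

lemma pairIncidence_transpose_mulVec (b : PairIdx n → R) (k : Fin n) :
    ((pairIncidence R n)ᵀ *ᵥ b) k = ∑ j, antisymmetrize b k j := by
  have h1 : ∀ f : Fin n → Fin n → R, ∑ p : PairIdx n, f p.1.1 p.1.2 =
      ∑ i, ∑ j, if i < j then f i j else 0 := by
    intro f
    rw [← Fintype.sum_prod_type' (f := fun i j => if i < j then f i j else 0),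
      ← Finset.sum_filter]
    exact (Finset.sum_subtype _ (by simp) fun p : Fin n × Fin n => f p.1 p.2).symm
  calc ((pairIncidence R n)ᵀ *ᵥ b) k
      = ∑ p : PairIdx n, ((if k = p.1.1 then 1 else 0) - (if k = p.1.2 then 1 else 0)) *
          antisymmetrize b p.1.1 p.1.2 := by
        simp [pairIncidence, mulVec, dotProduct, antisymmetrize_pair]
    _ = ∑ j, ((if k < j then antisymmetrize b k j else 0) -
          if j < k then antisymmetrize b j k else 0) := by
        rw [h1 fun i j => ((if k = i then 1 else 0) - (if k = j then 1 else 0)) *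
          antisymmetrize b i j]
        have h2 : ∀ i j : Fin n, (if i < j then ((if k = i then 1 else 0) -
            (if k = j then 1 else 0)) * antisymmetrize b i j else 0) =
            (if k = i then if i < j then antisymmetrize b i j else 0 else 0) -
            (if k = j then if i < j then antisymmetrize b i j else 0 else 0) := by
          intro i j
          split_ifs <;> simp
        simp only [h2, Finset.sum_sub_distrib, Finset.sum_ite_eq, Finset.mem_univ, if_true]
        rw [Finset.sum_comm]
        simp
    _ = ∑ j, antisymmetrize b k j := by
        refine Finset.sum_congr rfl fun j _ => ?_
        rcases lt_trichotomy k j with h | h | h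
        · simp [h, h.asymm]
        · simp [h, antisymmetrize_self]
        · simp [h, h.asymm, antisymmetrize_neg_swap b k j]

lemma sum_pairIncidence_transpose_mulVec (b : PairIdx n → R) :
    ∑ k, ((pairIncidence R n)ᵀ *ᵥ b) k = 0 := by
  simp only [pairIncidence_transpose_mulVec, sum_sum_antisymmetrize]

lemma pairIncidence_transpose_mulVec_mulVec (a : Fin n → R) (k : Fin n) :
    ((pairIncidence R n)ᵀ *ᵥ (pairIncidence R n *ᵥ a)) k = n * a k - ∑ j, a j := by
  simp [pairIncidence_transpose_mulVec, antisymmetrize_pairIncidence_mulVec]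

end Incidence

lemma card_pairIdx (n : ℕ) : Fintype.card (PairIdx n) = n * (n - 1) / 2 := by
  rw [Fintype.card_subtype, Finset.card_filter, Fintype.sum_prod_type_right]
  have : ∀ j : Fin n, (∑ i : Fin n, if i < j then 1 else 0) = (j : ℕ) := by
    intro j
    rw [← Finset.card_filter, ← Fin.card_Iio]
    congr 1
    ext
    simp
  simp only [this, Fin.sum_univ_eq_sum_range (fun i => i)]
  exact Finset.sum_range_id n

lemma AmatQ_mulVec (n : ℕ) (x : Fin n → ℚ) (y : PairIdx n → ℚ) :
    AmatQ n *ᵥ Sum.elim x y =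
      Sum.elim (-x - (pairIncidence ℚ n)ᵀ *ᵥ y) (-(pairIncidence ℚ n *ᵥ x) - (n : ℚ) • y) := by
  change fromBlocks (-1) (-(pairIncidence ℚ n)ᵀ) (-(pairIncidence ℚ n)) (-((n : ℚ) • 1)) *ᵥ _ = _
  rw [fromBlocks_mulVec]
  simp [neg_mulVec, smul_mulVec, sub_eq_add_neg]

lemma Amat_mulVec (n : ℕ) (x : Fin n → ℤ) (y : PairIdx n → ℤ) :
    Amat n *ᵥ Sum.elim x y =
      Sum.elim (-x - (pairIncidence ℤ n)ᵀ *ᵥ y) (-(pairIncidence ℤ n *ᵥ x) - (n : ℤ) • y) := by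
  change fromBlocks (-1) (-(pairIncidence ℤ n)ᵀ) (-(pairIncidence ℤ n)) (-((n : ℤ) • 1)) *ᵥ _ = _
  rw [fromBlocks_mulVec]
  simp only [neg_mulVec, smul_mulVec, sub_eq_add_neg, one_mulVec, Sum.elim_comp_inl,
    Sum.elim_comp_inr]

/-- The kernel of `A n` consists of the pairs `(x, -X x / n)` with `∑ x = 0`. -/
lemma mem_ker_AmatQ_iff {n : ℕ} (hn : n ≠ 0) (x : Fin n → ℚ) (y : PairIdx n → ℚ) :
    Sum.elim x y ∈ LinearMap.ker (AmatQ n).mulVecLin ↔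
      ∑ i, x i = 0 ∧ y = -((n : ℚ)⁻¹ • (pairIncidence ℚ n *ᵥ x)) := by
  have hn' : (n : ℚ) ≠ 0 := by exact_mod_cast hn
  rw [LinearMap.mem_ker, mulVecLin_apply, AmatQ_mulVec]
  constructor
  · intro h
    have hx : -x - (pairIncidence ℚ n)ᵀ *ᵥ y = 0 := funext fun i => congrFun h (Sum.inl i)
    have hy : -(pairIncidence ℚ n *ᵥ x) - (n : ℚ) • y = 0 :=
      funext fun i => congrFun h (Sum.inr i)
    constructor
    · have := sum_pairIncidence_transpose_mulVec y
      rw [← sub_eq_zero.1 hx] at this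
      simpa using this
    · rw [← smul_neg, sub_eq_zero.1 hy, smul_smul, inv_mul_cancel₀ hn', one_smul]
  · rintro ⟨hx, rfl⟩
    ext i
    cases i with
    | inl k =>
      simp [mulVec_neg, mulVec_smul, -mulVec_mulVec, pairIncidence_transpose_mulVec_mulVec, hx, hn']
    | inr p => simp [hn']

lemma finrank_ker_AmatQ {n : ℕ} (hn : n ≠ 0) :
    Module.finrank ℚ (LinearMap.ker (AmatQ n).mulVecLin) = n - 1 := by
  let s : Module.Dual ℚ (Fin n → ℚ) := ∑ i, LinearMap.proj i
  have hs_apply : ∀ x, s x = ∑ i, x i := fun x => by simp [s]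
  have hs : s ≠ 0 := by
    intro h
    have h1 : s 1 = 0 := by rw [h]; rfl
    rw [hs_apply] at h1
    exact hn (by simpa using h1)
  let e : LinearMap.ker (AmatQ n).mulVecLin →ₗ[ℚ] LinearMap.ker s :=
    LinearMap.codRestrict _ ((LinearMap.funLeft ℚ ℚ Sum.inl).domRestrict _) fun v => by
      have hv := v.2
      rw [← Sum.elim_comp_inl_inr v.1, mem_ker_AmatQ_iff hn] at hv
      rw [LinearMap.mem_ker, hs_apply]
      exact hv.1
  have he : Function.Bijective e := by
    constructor
    · rw [← LinearMap.ker_eq_bot, LinearMap.ker_eq_bot']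
      rintro ⟨v, hv⟩ hev
      have hx : v ∘ Sum.inl = 0 := congrArg Subtype.val hev
      rw [← Sum.elim_comp_inl_inr v, mem_ker_AmatQ_iff hn, hx] at hv
      refine Subtype.ext ?_
      change v = 0
      rw [← Sum.elim_comp_inl_inr v, hx, hv.2]
      ext i
      cases i <;> simp
    · rintro ⟨x, hx⟩
      rw [LinearMap.mem_ker, hs_apply] at hx
      exact ⟨⟨_, (mem_ker_AmatQ_iff hn x _).2 ⟨hx, rfl⟩⟩, rfl⟩
  rw [(LinearEquiv.ofBijective e he).finrank_eq]
  have := Module.Dual.finrank_ker_add_one_of_ne_zero hs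
  rw [Module.finrank_fin_fun] at this
  omega

/-- Elimination of the vertex generators of the cokernel of `A n`: `(a, b) ↦ b - X a`. -/
def eliminateVertices (n : ℕ) : (Fin n ⊕ PairIdx n → ℤ) →ₗ[ℤ] (PairIdx n → ℤ) :=
  LinearMap.funLeft ℤ ℤ Sum.inr - (pairIncidence ℤ n).mulVecLin ∘ₗ LinearMap.funLeft ℤ ℤ Sum.inl

lemma eliminateVertices_elim (n : ℕ) (a : Fin n → ℤ) (b : PairIdx n → ℤ) :
    eliminateVertices n (Sum.elim a b) = b - pairIncidence ℤ n *ᵥ a := rfl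

lemma mem_range_Amat_iff {n : ℕ} (v : Fin n ⊕ PairIdx n → ℤ) :
    v ∈ LinearMap.range (Amat n).mulVecLin ↔ ∃ y, eliminateVertices n v =
      (n : ℤ) • y - pairIncidence ℤ n *ᵥ ((pairIncidence ℤ n)ᵀ *ᵥ y) := by
  constructor
  · rintro ⟨w, rfl⟩
    refine ⟨-(w ∘ Sum.inr), ?_⟩
    rw [mulVecLin_apply, ← Sum.elim_comp_inl_inr w, Amat_mulVec, eliminateVertices_elim]
    simp only [Sum.elim_comp_inr, mulVec_neg, mulVec_sub, smul_neg]
    abel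
  · rintro ⟨y, hy⟩
    refine ⟨Sum.elim (-(v ∘ Sum.inl) + (pairIncidence ℤ n)ᵀ *ᵥ y) (-y), ?_⟩
    rw [← Sum.elim_comp_inl_inr v, eliminateVertices_elim] at hy
    rw [mulVecLin_apply, Amat_mulVec]
    conv_rhs => rw [← Sum.elim_comp_inl_inr v, sub_eq_iff_eq_add.1 hy]
    simp only [mulVec_neg, mulVec_add, smul_neg]
    congr 1 <;> abel

/-- The vectors whose reduction is a cycle of the complete graph. -/
def cycleSubmodule (n : ℕ) : Submodule ℤ (Fin n ⊕ PairIdx n → ℤ) :=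
  LinearMap.ker ((pairIncidence ℤ n)ᵀ.mulVecLin ∘ₗ eliminateVertices n)

lemma mem_cycleSubmodule {n : ℕ} {v : Fin n ⊕ PairIdx n → ℤ} :
    v ∈ cycleSubmodule n ↔ (pairIncidence ℤ n)ᵀ *ᵥ eliminateVertices n v = 0 := Iff.rfl

lemma range_Amat_le_cycleSubmodule (n : ℕ) :
    LinearMap.range (Amat n).mulVecLin ≤ cycleSubmodule n := by
  intro v hv
  obtain ⟨y, hy⟩ := (mem_range_Amat_iff v).1 hv
  rw [mem_cycleSubmodule, hy, mulVec_sub, mulVec_smul]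
  ext k
  simp [-mulVec_mulVec, pairIncidence_transpose_mulVec_mulVec, sum_pairIncidence_transpose_mulVec]

lemma mk_mem_torsion_iff {n : ℕ} (hn : n ≠ 0) (v : Fin n ⊕ PairIdx n → ℤ) :
    (LinearMap.range (Amat n).mulVecLin).mkQ v ∈
      Submodule.torsion ℤ ((Fin n ⊕ PairIdx n → ℤ) ⧸ LinearMap.range (Amat n).mulVecLin) ↔
      v ∈ cycleSubmodule n := by
  rw [Submodule.mem_torsion_iff]
  constructor
  · rintro ⟨⟨r, hr⟩, h⟩
    have hr0 : r ≠ 0 := nonZeroDivisors.ne_zero hr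
    have h' : r • v ∈ LinearMap.range (Amat n).mulVecLin := by
      rw [← Submodule.ker_mkQ (LinearMap.range (Amat n).mulVecLin), LinearMap.mem_ker, map_smul]
      exact h
    have h2 := mem_cycleSubmodule.1 (range_Amat_le_cycleSubmodule n h')
    rw [map_smul, mulVec_smul] at h2
    exact mem_cycleSubmodule.2 ((smul_eq_zero.1 h2).resolve_left hr0)
  · intro hv
    refine ⟨⟨(n : ℤ), mem_nonZeroDivisors_of_ne_zero (by exact_mod_cast hn)⟩, ?_⟩
    change (n : ℤ) • (LinearMap.range (Amat n).mulVecLin).mkQ v = 0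
    rw [← map_smul, ← LinearMap.mem_ker, Submodule.ker_mkQ, mem_range_Amat_iff]
    exact ⟨eliminateVertices n v, by
      rw [mem_cycleSubmodule.1 hv, map_smul, mulVec_zero, sub_zero]⟩

/-- The sums, modulo `m + 2`, of an edge vector around the triangles `0, i, j` with
`2 ≤ i < j`. -/
def triangleSums (m : ℕ) : (PairIdx (m + 2) → ℤ) →ₗ[ℤ] (PairIdx m → ZMod (m + 2)) :=
  AddMonoidHom.toIntLinearMap <| AddMonoidHom.mk' (fun b p =>
    ((antisymmetrize b p.1.1.succ.succ p.1.2.succ.succ + antisymmetrize b 0 p.1.1.succ.succ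
      - antisymmetrize b 0 p.1.2.succ.succ : ℤ) : ZMod (m + 2))) fun b c => by
    ext p
    simp only [antisymmetrize_add, Pi.add_apply]
    push_cast
    ring

lemma triangleSums_apply {m : ℕ} (b : PairIdx (m + 2) → ℤ) (p : PairIdx m) :
    triangleSums m b p =
      ((antisymmetrize b p.1.1.succ.succ p.1.2.succ.succ + antisymmetrize b 0 p.1.1.succ.succ
      - antisymmetrize b 0 p.1.2.succ.succ : ℤ) : ZMod (m + 2)) := rfl

lemma exists_cycle_triangleSums_eq {m : ℕ} (u : PairIdx m → ZMod (m + 2)) :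
    ∃ b, (pairIncidence ℤ (m + 2))ᵀ *ᵥ b = 0 ∧ triangleSums m b = u := by
  choose w hw using fun p => ZMod.intCast_surjective (u p)
  let r : Fin m → ℤ := fun i => ∑ l, antisymmetrize w i l
  let z : Fin (m + 2) → Fin (m + 2) → ℤ :=
    Fin.cons 0 (Fin.cons (Fin.cons 0 (Fin.cons 0 r))
      fun i => Fin.cons 0 (Fin.cons (-r i) (antisymmetrize w i)))
  have hz : ∀ i j, z i j = -z j i := by
    intro i j
    refine Fin.cases ?_ (fun i => Fin.cases ?_ (fun i => ?_) i) i <;>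
    refine Fin.cases ?_ (fun j => Fin.cases ?_ (fun j => ?_) j) j <;>
    simp [z]
    exact antisymmetrize_neg_swap w i j
  have hz' : ∀ i, z i i = 0 := fun i => by linarith [hz i i]
  have hanti := antisymmetrize_of_antisymm hz hz'
  refine ⟨fun p => z p.1.1 p.1.2, ?_, ?_⟩
  · ext k
    rw [pairIncidence_transpose_mulVec]
    simp only [hanti]
    refine Fin.cases ?_ (fun k => Fin.cases ?_ (fun k => ?_) k) k
    · simp [z]
    · simp [z, Fin.sum_univ_succ, r, sum_sum_antisymmetrize]
    · simp [z, Fin.sum_univ_succ, r]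
  · ext p
    rw [triangleSums_apply]
    simp only [hanti]
    simp [z, antisymmetrize_pair, hw]

/-- A cycle of the complete graph is a potential modulo `n` as soon as its sums around the
triangles `0, i, j` with `2 ≤ i < j` vanish. -/
lemma exists_potential_of_triangleSums_eq_zero {m : ℕ} {b : PairIdx (m + 2) → ℤ}
    (hb : (pairIncidence ℤ (m + 2))ᵀ *ᵥ b = 0) (ht : triangleSums m b = 0) (p : PairIdx (m + 2)) :
    ((b p + antisymmetrize b 0 p.1.1 - antisymmetrize b 0 p.1.2 : ℤ) : ZMod (m + 2)) = 0 := by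
  let z : Fin (m + 2) → Fin (m + 2) → ZMod (m + 2) := fun i j => (antisymmetrize b i j : ℤ)
  have hz : ∀ i j, z i j = -z j i := fun i j => by
    simp only [z]
    rw [antisymmetrize_neg_swap b i j, Int.cast_neg]
  have hz' : ∀ i, z i i = 0 := fun i => by simp [z, antisymmetrize_self]
  have hsum : ∀ k, ∑ j, z k j = 0 := fun k => by
    have := congrFun hb k
    rw [pairIncidence_transpose_mulVec] at this
    simp only [z]
    rw [← Int.cast_sum, this]
    simp
  have hlt : ∀ i j : Fin m, i < j →
      z i.succ.succ j.succ.succ = z 0 j.succ.succ - z 0 i.succ.succ := fun i j h => by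
    have := congrFun ht ⟨(i, j), h⟩
    rw [triangleSums_apply] at this
    simp only [z]
    push_cast [Pi.zero_apply] at this
    linear_combination this
  have hge : ∀ i j : Fin m, z i.succ.succ j.succ.succ = z 0 j.succ.succ - z 0 i.succ.succ := by
    intro i j
    rcases lt_trichotomy i j with h | h | h
    · exact hlt i j h
    · simp [h, hz']
    · rw [hz, hlt j i h]
      ring
  have hone : ∀ j : Fin m, z 1 j.succ.succ = z 0 j.succ.succ - z 0 1 := by
    intro j
    have h0 := hsum 0
    have hj := hsum j.succ.succ
    rw [Fin.sum_univ_succ, Fin.sum_univ_succ] at h0 hj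
    simp only [hge, Finset.sum_sub_distrib, Finset.sum_const, Finset.card_univ, Fintype.card_fin,
      nsmul_eq_mul, hz'] at h0 hj
    have hm : ((m : ZMod (m + 2)) + 2) = 0 := by
      exact_mod_cast ZMod.natCast_self (m + 2)
    rw [Fin.succ_zero_eq_one] at h0 hj
    rw [hz j.succ.succ 0, hz j.succ.succ 1] at hj
    linear_combination h0 - hj - z 0 j.succ.succ * hm
  have hall : ∀ i j, z i j = z 0 j - z 0 i := by
    intro i j
    refine Fin.cases ?_ (fun i => Fin.cases ?_ (fun i => ?_) i) i <;>
    refine Fin.cases ?_ (fun j => Fin.cases ?_ (fun j => ?_) j) j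
    · simp [hz']
    · simp [hz']
    · simp [hz']
    · rw [hz', hz]; ring
    · simp [hz']
    · exact hone j
    · rw [hz', hz]; ring
    · rw [Fin.succ_zero_eq_one, hz, hone]; ring
    · exact hge i j
  have := hall p.1.1 p.1.2
  simp only [z] at this
  rw [antisymmetrize_pair] at this
  push_cast
  rw [this]
  ring

lemma triangleSums_eq_zero_iff {m : ℕ} {b : PairIdx (m + 2) → ℤ}
    (hb : (pairIncidence ℤ (m + 2))ᵀ *ᵥ b = 0) :
    triangleSums m b = 0 ↔ ∃ y, b = ((m + 2 : ℕ) : ℤ) • y -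
      pairIncidence ℤ (m + 2) *ᵥ ((pairIncidence ℤ (m + 2))ᵀ *ᵥ y) := by
  constructor
  · intro ht
    let a : Fin (m + 2) → ℤ := antisymmetrize b 0
    have hdvd : ∀ p : PairIdx (m + 2), ((m + 2 : ℕ) : ℤ) ∣ b p + a p.1.1 - a p.1.2 := fun p =>
      (ZMod.intCast_zmod_eq_zero_iff_dvd _ (m + 2)).1
        (exists_potential_of_triangleSums_eq_zero hb ht p)
    choose y hy using hdvd
    have hy' : ((m + 2 : ℕ) : ℤ) • y = b + pairIncidence ℤ (m + 2) *ᵥ a := by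
      ext p
      rw [Pi.smul_apply, Pi.add_apply, pairIncidence_mulVec, smul_eq_mul, ← hy p]
      ring
    refine ⟨y, ?_⟩
    have hty := congrArg (fun v => (pairIncidence ℤ (m + 2))ᵀ *ᵥ v) hy'
    simp only [mulVec_smul, mulVec_add, hb, zero_add] at hty
    have hXX : pairIncidence ℤ (m + 2) *ᵥ ((pairIncidence ℤ (m + 2))ᵀ *ᵥ y) =
        pairIncidence ℤ (m + 2) *ᵥ a := by
      ext p
      have h1 := congrFun hty p.1.1
      have h2 := congrFun hty p.1.2
      rw [pairIncidence_transpose_mulVec_mulVec, Pi.smul_apply, smul_eq_mul] at h1 h2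
      rw [pairIncidence_mulVec, pairIncidence_mulVec]
      have hm : ((m + 2 : ℕ) : ℤ) ≠ 0 := by positivity
      apply mul_left_cancel₀ hm
      linear_combination h1 - h2
    rw [hXX, hy', add_sub_cancel_right]
  · rintro ⟨y, rfl⟩
    ext p
    have hsub : ∀ i j, antisymmetrize (((m + 2 : ℕ) : ℤ) • y -
        pairIncidence ℤ (m + 2) *ᵥ ((pairIncidence ℤ (m + 2))ᵀ *ᵥ y)) i j =
        ((m + 2 : ℕ) : ℤ) * antisymmetrize y i j - (((pairIncidence ℤ (m + 2))ᵀ *ᵥ y) i -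
          ((pairIncidence ℤ (m + 2))ᵀ *ᵥ y) j) := by
      intro i j
      rw [← antisymmetrize_pairIncidence_mulVec]
      unfold antisymmetrize
      split_ifs <;> simp; ring
    rw [triangleSums_apply, hsub, hsub, hsub, Pi.zero_apply,
      ZMod.intCast_zmod_eq_zero_iff_dvd _ (m + 2)]
    exact ⟨antisymmetrize y p.1.1.succ.succ p.1.2.succ.succ + antisymmetrize y 0 p.1.1.succ.succ
      - antisymmetrize y 0 p.1.2.succ.succ, by ring⟩

lemma nonempty_torsion_coker_Amat_equiv (m : ℕ) :
    Nonempty ((Submodule.torsion ℤ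
        (((Fin (m + 2) ⊕ PairIdx (m + 2)) → ℤ) ⧸ LinearMap.range (Amat (m + 2)).mulVecLin))
      ≃ₗ[ℤ] (PairIdx m → ZMod (m + 2))) := by
  let F := ((LinearMap.range (Amat (m + 2)).mulVecLin).mkQ.domRestrict
    (cycleSubmodule (m + 2))).codRestrict (Submodule.torsion ℤ _)
    fun v => (mk_mem_torsion_iff (by omega) v.1).2 v.2
  let G := (triangleSums m ∘ₗ eliminateVertices (m + 2)).domRestrict (cycleSubmodule (m + 2))
  have hF : Function.Surjective F := by
    rintro ⟨q, hq⟩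
    obtain ⟨v, rfl⟩ := Submodule.mkQ_surjective _ q
    exact ⟨⟨v, (mk_mem_torsion_iff (by omega) v).1 hq⟩, rfl⟩
  have hG : Function.Surjective G := by
    intro u
    obtain ⟨b, hb, hbu⟩ := exists_cycle_triangleSums_eq u
    have h : eliminateVertices (m + 2) (Sum.elim 0 b) = b := by
      rw [eliminateVertices_elim, mulVec_zero, sub_zero]
    refine ⟨⟨Sum.elim 0 b, mem_cycleSubmodule.2 (by rw [h, hb])⟩, ?_⟩
    change triangleSums m (eliminateVertices (m + 2) (Sum.elim 0 b)) = u
    rw [h, hbu]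
  have hFG : LinearMap.ker F = LinearMap.ker G := by
    ext ⟨v, hv⟩
    have hG' : (⟨v, hv⟩ : cycleSubmodule (m + 2)) ∈ LinearMap.ker G ↔
        triangleSums m (eliminateVertices (m + 2) v) = 0 := Iff.rfl
    have hF' : (⟨v, hv⟩ : cycleSubmodule (m + 2)) ∈ LinearMap.ker F ↔
        v ∈ LinearMap.range (Amat (m + 2)).mulVecLin := by
      rw [LinearMap.mem_ker, Subtype.ext_iff]
      exact Submodule.Quotient.mk_eq_zero _
    rw [hF', hG', mem_range_Amat_iff, triangleSums_eq_zero_iff (mem_cycleSubmodule.1 hv)]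
  exact ⟨(F.quotKerEquivOfSurjective hF).symm ≪≫ₗ Submodule.quotEquivOfEq _ _ hFG ≪≫ₗ
    G.quotKerEquivOfSurjective hG⟩

/-- For a generic arrangement of `n ≥ 2` hyperplanes in `ℂ³`, the first homology of
the Milnor fiber boundary computed from its plumbing graph (all genera zero,
`b₁(Γ) = (n−1)(n−2)/2`) is `ℤ^{n(n−1)/2} ⊕ (ℤ/nℤ)^{(n−2)(n−3)/2}`: the free rank
`corank(A_n) + b₁(Γ)` equals `n(n−1)/2`, and the torsion submodule of `coker(A_n)`
is isomorphic to `(ℤ/nℤ)^{(n−2)(n−3)/2}`. -/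
theorem stmt18 (n : ℕ) (hn : 2 ≤ n) :
    Module.finrank ℚ (LinearMap.ker (Matrix.mulVecLin (AmatQ n))) + (n - 1) * (n - 2) / 2
      = n * (n - 1) / 2 ∧
    Nonempty ((Submodule.torsion ℤ
        (((Fin n ⊕ PairIdx n) → ℤ) ⧸ LinearMap.range (Matrix.mulVecLin (Amat n))))
      ≃ₗ[ℤ] (Fin ((n - 2) * (n - 3) / 2) → ZMod n)) := by
  obtain ⟨m, rfl⟩ := Nat.exists_eq_add_of_le' hn
  constructor
  · rw [finrank_ker_AmatQ (by omega)]
    have h1 : (m + 2) * (m + 1) = (m + 1) * m + 2 * (m + 1) := by ring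
    simp only [Nat.add_sub_cancel, show m + 2 - 1 = m + 1 by omega]
    omega
  · obtain ⟨e⟩ := nonempty_torsion_coker_Amat_equiv m
    have hcard : Fintype.card (PairIdx m) = (m + 2 - 2) * (m + 2 - 3) / 2 := by
      rw [card_pairIdx, Nat.add_sub_cancel, show m + 2 - 3 = m - 1 by omega]
    exact ⟨e ≪≫ₗ LinearEquiv.funCongrLeft ℤ (ZMod (m + 2)) (Fintype.equivFinOfCardEq hcard).symm⟩
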